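/- Lower bound for the renormalized energy of well-separated configurations: Let U ⊂ ℝ^d be a bounded open set, Λ ⊂ U a finite set, a : U → ℝ a bounded continuous function, and g a C² function on a neighborhood of the closure of U with Δg = c_d·a on U; set h = Σ_{p∈Λ} w(·−p) + g, so that −Δh = c_d(Σ_{p∈Λ} δ_p − a) in U. Assume min( min_{p≠p'∈Λ} |p−p'|, min_{p∈Λ} dist(p, ∂U) ) ≥ η_0 > 0. Then liminf_{η→0} ( ∫_{U ∖ ⋃_{p∈Λ} B(p,η)} |∇h|² − c_d w(η)·#Λ ) ≥ −C·#Λ, where C > 0 depends only on d, ‖a‖_{L^∞(U)} and η_0. -/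

import Mathlib

open MeasureTheory Metric Real Filter
open scoped Topology ENNReal BigOperators

noncomputable section

/-- Euclidean space `ℝ^d`. -/
abbrev Euc (d : ℕ) := EuclideanSpace ℝ (Fin d)

/-- The Coulomb kernel `w` : `|x|^{2-d}` for `d ≥ 3`, `-log |x|` for `d = 2`. -/
def ck (d : ℕ) (x : Euc d) : ℝ :=
  if d = 2 then -Real.log ‖x‖ else ‖x‖ ^ ((2 : ℝ) - d)

/-- The Coulomb kernel as a function of the radius. -/
def ckr (d : ℕ) (r : ℝ) : ℝ :=
  if d = 2 then -Real.log r else r ^ ((2 : ℝ) - d)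

/-- The constant `c_d`: `2π` for `d = 2` and `(d−2)|S^{d−1}|` for `d ≥ 3`
(using `|S^{d-1}| = d · |B(0,1)|`). -/
def cConst (d : ℕ) : ℝ :=
  if d = 2 then 2 * π
  else ((d : ℝ) - 2) * d * (volume (ball (0 : Euc d) 1)).toReal

/-- The constant `κ` in `w'(r) = -κ r^{1-d}`: `1` for `d = 2` and `d - 2` for `d ≥ 3`. -/
def coulombFactor (d : ℕ) : ℝ := if d = 2 then 1 else (d : ℝ) - 2

lemma coulombFactor_pos {d : ℕ} (hd : 2 ≤ d) : 0 < coulombFactor d := by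
  unfold coulombFactor
  split_ifs with h
  · exact one_pos
  · have : (3 : ℝ) ≤ d := by exact_mod_cast (by omega : 3 ≤ d)
    linarith

lemma cConst_eq (d : ℕ) :
    cConst d = coulombFactor d * (d * volume.real (ball (0 : Euc d) 1)) := by
  unfold cConst coulombFactor
  split_ifs with h
  · subst h
    simp [Measure.real, EuclideanSpace.volume_ball_fin_two, Real.pi_pos.le]
  · rw [Measure.real, mul_assoc]

lemma cConst_nonneg {d : ℕ} (hd : 2 ≤ d) : 0 ≤ cConst d := by
  rw [cConst_eq]
  have := coulombFactor_pos hd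
  positivity

lemma ck_eq (d : ℕ) (x : Euc d) : ck d x = ckr d ‖x‖ := rfl

lemma hasDerivAt_ckr (d : ℕ) {r : ℝ} (hr : 0 < r) :
    HasDerivAt (ckr d) (-(coulombFactor d * r ^ (1 - d : ℝ))) r := by
  unfold ckr coulombFactor
  split_ifs with h
  · subst h
    refine (Real.hasDerivAt_log hr.ne').neg.congr_deriv ?_
    norm_num [Real.rpow_neg_one]
  · refine (Real.hasDerivAt_rpow_const (p := (2 : ℝ) - d) (Or.inl hr.ne')).congr_deriv ?_
    rw [show (2 : ℝ) - d - 1 = 1 - d by ring]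
    ring

lemma hasGradientAt_norm {d : ℕ} {x : Euc d} (hx : x ≠ 0) :
    HasGradientAt (fun y : Euc d => ‖y‖) (‖x‖⁻¹ • x) x := by
  have h1 := (hasStrictFDerivAt_norm_sq x).hasFDerivAt.sqrt (by positivity)
  simp only [Real.sqrt_sq (norm_nonneg _)] at h1
  rw [hasGradientAt_iff_hasFDerivAt]
  refine h1.congr_fderiv ?_
  ext y
  have : ‖x‖ ≠ 0 := norm_ne_zero_iff.2 hx
  simp
  field_simp

lemma HasGradientAt.of_comp_norm {d : ℕ} {x : Euc d} (hx : x ≠ 0) {f : ℝ → ℝ} {f' : ℝ}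
    (hf : HasDerivAt f f' ‖x‖) :
    HasGradientAt (fun y : Euc d => f ‖y‖) ((f' * ‖x‖⁻¹) • x) x := by
  have h2 := HasDerivAt.comp_hasFDerivAt x hf (hasGradientAt_norm hx).hasFDerivAt
  rw [hasGradientAt_iff_hasFDerivAt]
  refine h2.congr_fderiv ?_
  ext y
  simp [mul_assoc]

/-- The gradient of the Coulomb kernel away from the origin. -/
def ckGrad (d : ℕ) (x : Euc d) : Euc d := (-(coulombFactor d * ‖x‖ ^ (-(d : ℝ)))) • x

lemma hasGradientAt_ck (d : ℕ) {x : Euc d} (hx : x ≠ 0) :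
    HasGradientAt (ck d) (ckGrad d x) x := by
  have hx' : 0 < ‖x‖ := norm_pos_iff.2 hx
  have h := HasGradientAt.of_comp_norm hx (hasDerivAt_ckr d hx')
  unfold ckGrad
  simp only [funext (ck_eq d)]
  convert h using 2
  rw [sub_eq_add_neg, Real.rpow_add hx', Real.rpow_one]
  field_simp

lemma contDiffAt_ckGrad (d : ℕ) {x : Euc d} (hx : x ≠ 0) : ContDiffAt ℝ 1 (ckGrad d) x := by
  unfold ckGrad
  have h1 : ContDiffAt ℝ 1 (fun y : Euc d => ‖y‖) x := contDiffAt_norm ℝ hx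
  exact (contDiffAt_const.mul (h1.rpow_const_of_ne (norm_ne_zero_iff.2 hx))).neg.smul contDiffAt_id

lemma norm_ckGrad_sq (d : ℕ) {x : Euc d} (hx : x ≠ 0) :
    ‖ckGrad d x‖ ^ 2 = coulombFactor d ^ 2 * (‖x‖ ^ (1 - d : ℝ)) ^ 2 := by
  have hx' : 0 < ‖x‖ := norm_pos_iff.2 hx
  rw [ckGrad, norm_smul, norm_neg, norm_mul, sub_eq_neg_add, Real.rpow_add hx', Real.rpow_one,
    mul_pow, mul_pow, mul_pow, Real.norm_eq_abs, Real.norm_eq_abs, sq_abs, sq_abs]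
  ring

lemma sum_fderiv_ckGrad (d : ℕ) {x : Euc d} (hx : x ≠ 0) :
    ∑ i : Fin d, fderiv ℝ (fun y => ckGrad d y i) x (EuclideanSpace.single i (1 : ℝ)) = 0 := by
  have hx' : 0 < ‖x‖ := norm_pos_iff.2 hx
  have hF := (HasGradientAt.of_comp_norm hx
    ((Real.hasDerivAt_rpow_const (p := -(d : ℝ)) (Or.inl hx'.ne')).const_mul
      (coulombFactor d)).neg).hasFDerivAt
  have key (i : Fin d) :
      fderiv ℝ (fun y => ckGrad d y i) x (EuclideanSpace.single i (1 : ℝ))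
        = coulombFactor d * ‖x‖ ^ (-(d : ℝ)) * (d * ‖x‖⁻¹ ^ 2 * x i ^ 2 - 1) := by
    have hc : HasFDerivAt (fun y : Euc d => y i) (EuclideanSpace.proj i : Euc d →L[ℝ] ℝ) x :=
      (EuclideanSpace.proj i : Euc d →L[ℝ] ℝ).hasFDerivAt
    have h := hF.mul hc
    have he : (fun y => ckGrad d y i)
        = (fun y : Euc d => -(coulombFactor d * ‖y‖ ^ (-(d : ℝ)))) * fun y => y i := by
      ext y
      simp [ckGrad]
    rw [he]
    erw [h.fderiv]
    rw [Real.rpow_sub_one hx'.ne']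
    simp [EuclideanSpace.inner_single_right]
    field_simp
    ring
  have hs : ∑ i : Fin d, x i ^ 2 = ‖x‖ ^ 2 := (EuclideanSpace.real_norm_sq_eq x).symm
  simp_rw [key, ← Finset.mul_sum, Finset.sum_sub_distrib, ← Finset.mul_sum, hs]
  simp only [Finset.sum_const, Finset.card_univ, Fintype.card_fin, nsmul_eq_mul, mul_one]
  field_simp
  simp

lemma lipschitzOnWith_ckr {d : ℕ} (hd : 2 ≤ d) {η : ℝ} (hη : 0 < η) :
    LipschitzOnWith (coulombFactor d * η ^ (1 - d : ℝ)).toNNReal (ckr d) (Set.Ici η) := by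
  have hd' : (2 : ℝ) ≤ d := by exact_mod_cast hd
  have hκ := coulombFactor_pos hd
  refine (convex_Ici η).lipschitzOnWith_of_nnnorm_hasDerivWithin_le
    (fun t ht => (hasDerivAt_ckr d (hη.trans_le ht)).hasDerivWithinAt) fun t ht => ?_
  have ht0 : 0 < t := hη.trans_le ht
  rw [← NNReal.coe_le_coe, coe_nnnorm, norm_neg, Real.norm_of_nonneg (by positivity),
    Real.coe_toNNReal _ (by positivity)]
  exact mul_le_mul_of_nonneg_left (Real.rpow_le_rpow_of_nonpos hη ht (by linarith)) hκ.le

lemma ckr_sub_ckr_le {d : ℕ} (hd : 2 ≤ d) {s t : ℝ} (hs : 0 < s) (hst : s ≤ t) :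
    ckr d s - ckr d t ≤ coulombFactor d * s ^ (1 - d : ℝ) * (t - s) := by
  have hκ := coulombFactor_pos hd
  have h := (lipschitzOnWith_ckr hd hs).dist_le_mul s Set.self_mem_Ici t hst
  rw [Real.coe_toNNReal _ (by positivity), Real.dist_eq, Real.dist_eq, abs_sub_comm s t,
    abs_of_nonneg (sub_nonneg.2 hst)] at h
  exact (le_abs_self _).trans h

lemma antitoneOn_ckr {d : ℕ} (hd : 2 ≤ d) : AntitoneOn (ckr d) (Set.Ioi 0) := by
  have hκ := coulombFactor_pos hd
  refine antitoneOn_of_hasDerivWithinAt_nonpos (convex_Ioi 0)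
    (f' := fun r => -(coulombFactor d * r ^ (1 - d : ℝ)))
    (fun t ht => (hasDerivAt_ckr d ht).continuousAt.continuousWithinAt)
    (fun t ht => (hasDerivAt_ckr d (interior_subset ht)).hasDerivWithinAt) fun t ht => ?_
  have ht0 : 0 < t := interior_subset ht
  simp only [Left.neg_nonpos_iff]
  positivity

/-- The Coulomb kernel truncated at radius `η` and shifted so as to vanish beyond radius `r`. -/
def ckTrunc (d : ℕ) (η r t : ℝ) : ℝ := ckr d (max η (min t r)) - ckr d r

section ckTrunc

variable {d : ℕ} {η r t : ℝ}

lemma ckTrunc_of_le (hηr : η ≤ r) (ht : r ≤ t) : ckTrunc d η r t = 0 := by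
  simp [ckTrunc, ht, hηr]

lemma ckTrunc_of_le_left (hηr : η ≤ r) (ht : t ≤ η) :
    ckTrunc d η r t = ckr d η - ckr d r := by
  simp [ckTrunc, ht, ht.trans hηr]

lemma ckTrunc_of_mem (h1 : η ≤ t) (h2 : t ≤ r) : ckTrunc d η r t = ckr d t - ckr d r := by
  simp [ckTrunc, h1, h2]

lemma exists_lipschitzWith_ckTrunc (hd : 2 ≤ d) (hη : 0 < η) :
    ∃ C, LipschitzWith C (ckTrunc d η r) := by
  have h1 : LipschitzWith 1 fun t => max η (min t r) :=
    (LipschitzWith.id.min_const r).const_max η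
  have h2 := ((lipschitzOnWith_ckr hd hη).comp (lipschitzOnWith_univ.2 h1)
    fun t _ => Set.mem_Ici.2 (le_max_left _ _))
  rw [lipschitzOnWith_univ] at h2
  exact ⟨_, h2.sub (LipschitzWith.const (ckr d r))⟩

lemma ckTrunc_nonneg (hd : 2 ≤ d) (hη : 0 < η) (hηr : η ≤ r) : 0 ≤ ckTrunc d η r t :=
  sub_nonneg.2 <| antitoneOn_ckr hd (hη.trans_le (le_max_left _ _)) (hη.trans_le hηr)
    (max_le hηr (min_le_right _ _))

lemma pow_mul_ckTrunc_le (hd : 2 ≤ d) (hη : 0 < η) (ht : 0 < t) (htr : t ≤ r) :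
    t ^ (d - 1) * ckTrunc d η r t ≤ coulombFactor d * r := by
  have hκ := coulombFactor_pos hd
  have h1 : ckTrunc d η r t ≤ coulombFactor d * t ^ (1 - d : ℝ) * r := by
    calc ckTrunc d η r t ≤ ckr d t - ckr d r := by
          refine sub_le_sub_right (antitoneOn_ckr hd ht (hη.trans_le (le_max_left _ _)) ?_) _
          exact le_max_of_le_right (le_min le_rfl htr)
      _ ≤ coulombFactor d * t ^ (1 - d : ℝ) * (r - t) := ckr_sub_ckr_le hd ht htr
      _ ≤ _ := by gcongr; linarith
  have h2 : t ^ (d - 1) * t ^ (1 - d : ℝ) = 1 := by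
    rw [← Real.rpow_natCast, ← Real.rpow_add ht, Nat.cast_sub (by omega)]
    simp
  calc t ^ (d - 1) * ckTrunc d η r t
      ≤ t ^ (d - 1) * (coulombFactor d * t ^ (1 - d : ℝ) * r) := by gcongr
    _ = coulombFactor d * r * (t ^ (d - 1) * t ^ (1 - d : ℝ)) := by ring
    _ = _ := by rw [h2, mul_one]

lemma integral_ckTrunc_le (hd : 2 ≤ d) (hη : 0 < η) (hηr : η ≤ r) (p : Euc d) :
    ∫ z, ckTrunc d η r ‖z - p‖ ≤ cConst d * r ^ 2 := by
  have hr : 0 < r := hη.trans_le hηr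
  have : Nonempty (Fin d) := ⟨⟨0, by omega⟩⟩
  rw [integral_sub_right_eq_self (fun z : Euc d => ckTrunc d η r ‖z‖) p,
    integral_fun_norm_addHaar volume (ckTrunc d η r), cConst_eq]
  simp only [finrank_euclideanSpace, Fintype.card_fin, nsmul_eq_mul, smul_eq_mul]
  have key : ∫ y in Set.Ioi (0 : ℝ), y ^ (d - 1) * ckTrunc d η r y ≤ coulombFactor d * r ^ 2 := by
    calc ∫ y in Set.Ioi (0 : ℝ), y ^ (d - 1) * ckTrunc d η r y
        = ∫ y in Set.Ioc (0 : ℝ) r, y ^ (d - 1) * ckTrunc d η r y := by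
          refine (setIntegral_eq_of_subset_of_forall_sdiff_eq_zero measurableSet_Ioi
            Set.Ioc_subset_Ioi_self fun y hy => ?_)
          have : r ≤ y := by
            by_contra! h
            exact hy.2 ⟨hy.1, h.le⟩
          rw [ckTrunc_of_le hηr this, mul_zero]
      _ ≤ ∫ y in Set.Ioc (0 : ℝ) r, coulombFactor d * r := by
          refine integral_mono_of_nonneg ?_ (integrable_const _) ?_
          · refine (ae_restrict_iff' measurableSet_Ioc).2 (Eventually.of_forall fun y hy => ?_)
            exact mul_nonneg (pow_nonneg hy.1.le _) (ckTrunc_nonneg hd hη hηr)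
          · refine (ae_restrict_iff' measurableSet_Ioc).2 (Eventually.of_forall fun y hy => ?_)
            exact pow_mul_ckTrunc_le hd hη hy.1 hy.2
      _ = coulombFactor d * r ^ 2 := by
          simp [hr.le]
          ring
  calc _ ≤ (d : ℝ) * (volume.real (ball (0 : Euc d) 1) * (coulombFactor d * r ^ 2)) := by gcongr
    _ = _ := by ring

end ckTrunc

lemma setIntegral_norm_ckGrad_sq {d : ℕ} (hd : 2 ≤ d) {η r : ℝ} (hη : 0 < η) (hηr : η ≤ r)
    (p : Euc d) :
    ∫ z in ball p r \ ball p η, ‖ckGrad d (z - p)‖ ^ 2 = cConst d * (ckr d η - ckr d r) := by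
  have : Nonempty (Fin d) := ⟨⟨0, by omega⟩⟩
  set G : ℝ → ℝ := (Set.Ico η r).indicator
    fun t => coulombFactor d ^ 2 * (t ^ (1 - d : ℝ)) ^ 2 with hG
  have h1 : (ball p r \ ball p η).indicator (fun z => ‖ckGrad d (z - p)‖ ^ 2)
      = fun z => G ‖z - p‖ := by
    ext z
    by_cases hz : ‖z - p‖ ∈ Set.Ico η r
    · rw [hG, Set.indicator_of_mem hz, Set.indicator_of_mem, norm_ckGrad_sq]
      · exact norm_pos_iff.1 (hη.trans_le hz.1)
      · simpa [dist_eq_norm, and_comm] using hz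
    · rw [hG, Set.indicator_of_notMem hz, Set.indicator_of_notMem]
      simpa [dist_eq_norm, and_comm, imp.swap] using hz
  rw [← integral_indicator (measurableSet_ball.diff measurableSet_ball), h1,
    integral_sub_right_eq_self (fun z : Euc d => G ‖z‖) p, integral_fun_norm_addHaar volume G,
    cConst_eq]
  simp only [finrank_euclideanSpace, Fintype.card_fin, nsmul_eq_mul, smul_eq_mul]
  have key : ∫ y in Set.Ioi (0 : ℝ), y ^ (d - 1) * G y
      = coulombFactor d * (ckr d η - ckr d r) := by
    calc ∫ y in Set.Ioi (0 : ℝ), y ^ (d - 1) * G y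
        = ∫ y in Set.Ico η r, y ^ (d - 1) * G y := by
          refine (setIntegral_eq_of_subset_of_forall_sdiff_eq_zero measurableSet_Ioi
            (fun y hy => hη.trans_le hy.1) fun y hy => ?_)
          rw [hG, Set.indicator_of_notMem hy.2, mul_zero]
      _ = ∫ y in Set.Ico η r, -coulombFactor d * -(coulombFactor d * y ^ (1 - d : ℝ)) := by
          refine setIntegral_congr_fun measurableSet_Ico fun y hy => ?_
          have hy0 : 0 < y := hη.trans_le hy.1
          have h2 : y ^ (d - 1) * y ^ (1 - d : ℝ) = 1 := by
            rw [← Real.rpow_natCast, ← Real.rpow_add hy0, Nat.cast_sub (by omega)]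
            simp
          simp only [hG, Set.indicator_of_mem hy]
          linear_combination (coulombFactor d ^ 2 * y ^ (1 - d : ℝ)) * h2
      _ = -coulombFactor d * ∫ y in η..r, -(coulombFactor d * y ^ (1 - d : ℝ)) := by
          rw [integral_const_mul, integral_Ico_eq_integral_Ioc,
            intervalIntegral.integral_of_le hηr]
      _ = _ := by
          have hpos : ∀ y ∈ Set.uIcc η r, 0 < y := fun y hy => by
            rw [Set.uIcc_of_le hηr] at hy
            exact hη.trans_le hy.1
          rw [intervalIntegral.integral_eq_sub_of_hasDerivAt
            (fun y hy => hasDerivAt_ckr d (hpos y hy))]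
          · ring
          · refine ContinuousOn.intervalIntegrable fun y hy => ?_
            exact ((Real.continuousAt_rpow_const y _ (Or.inl (hpos y hy).ne')).const_mul
              _).neg.continuousWithinAt
  rw [key]
  ring

lemma exists_lipschitzWith_eventuallyEq {d : ℕ} {p : Euc d} {r R : ℝ} (hr : 0 < r) (hrR : r < R)
    {v : Euc d → ℝ} (hv : ContDiffOn ℝ 1 v (ball p R)) :
    ∃ V : Euc d → ℝ, (∃ C, LipschitzWith C V) ∧ ∀ x ∈ closedBall p r, V =ᶠ[𝓝 x] v := by
  let χ : ContDiffBump p :=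
    ⟨(2 * r + R) / 3, (r + 2 * R) / 3, by linarith, by linarith⟩
  have hin : χ.rIn = (2 * r + R) / 3 := rfl
  have hout : χ.rOut = (r + 2 * R) / 3 := rfl
  have hsupp : tsupport (fun x => χ x * v x) ⊆ closedBall p χ.rOut :=
    (tsupport_mul_subset_left (f := χ) (g := v)).trans χ.tsupport_eq.subset
  refine ⟨fun x => χ x * v x, ?_, fun x hx => ?_⟩
  · refine ContDiff.lipschitzWith_of_hasCompactSupport
      (HasCompactSupport.of_support_subset_isCompact (isCompact_closedBall p χ.rOut)
        (subset_tsupport _ |>.trans hsupp)) (𝕂 := ℝ) (n := 1)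
      (contDiff_iff_contDiffAt.2 fun x => ?_) one_ne_zero
    by_cases hx : x ∈ tsupport fun x => χ x * v x
    swap
    · exact contDiffAt_const.congr_of_eventuallyEq (notMem_tsupport_iff_eventuallyEq.1 hx)
    have hx' : x ∈ ball p R := closedBall_subset_ball (by linarith) (hsupp hx)
    exact χ.contDiffAt.mul (hv.contDiffAt (isOpen_ball.mem_nhds hx'))
  · have hx' : x ∈ ball p χ.rIn := closedBall_subset_ball (by linarith) hx
    filter_upwards [χ.eventuallyEq_one_of_mem_ball hx'] with y hy
    simp [hy]

lemma integral_lineDeriv_mul_eq_neg {d : ℕ} {p : Euc d} {r R : ℝ} (hr : 0 < r) (hrR : r < R)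
    {v : Euc d → ℝ} (hv : ContDiffOn ℝ 1 v (ball p R)) {f : Euc d → ℝ} {C : NNReal}
    (hf : LipschitzWith C f) (hf0 : ∀ x ∉ closedBall p r, f x = 0) (e : Euc d) :
    ∫ x, lineDeriv ℝ f x e * v x = -∫ x, f x * fderiv ℝ v x e := by
  obtain ⟨V, ⟨D, hV⟩, hVv⟩ := exists_lipschitzWith_eventuallyEq hr hrR hv
  have hcs : HasCompactSupport f :=
    HasCompactSupport.intro (isCompact_closedBall p r) hf0
  have h := LipschitzWith.integral_lineDeriv_mul_eq (μ := volume) hV hf hcs e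
  have h1 : ∫ x, lineDeriv ℝ V x e * f x = ∫ x, f x * fderiv ℝ v x e := by
    congr 1 with x
    by_cases hx : x ∈ closedBall p r
    · have hd : DifferentiableAt ℝ v x := (hv.contDiffAt (isOpen_ball.mem_nhds
        (closedBall_subset_ball hrR hx))).differentiableAt one_ne_zero
      rw [(hVv x hx).lineDeriv_eq, hd.lineDeriv_eq_fderiv, mul_comm]
    · rw [hf0 x hx, mul_zero, zero_mul]
  have h2 : ∫ x, lineDeriv ℝ f x (-e) * V x = -∫ x, lineDeriv ℝ f x e * v x := by
    rw [← integral_neg]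
    congr 1 with x
    rw [lineDeriv_neg]
    by_cases hx : x ∈ closedBall p r
    · rw [(hVv x hx).eq_of_nhds, neg_mul]
    · have : f =ᶠ[𝓝 x] fun _ => 0 := by
        filter_upwards [isClosed_closedBall.isOpen_compl.mem_nhds hx] with y hy using hf0 y hy
      rw [this.lineDeriv_eq]
      simp [lineDeriv]
  linarith

lemma lineDeriv_ckTrunc {d : ℕ} {η r : ℝ} (hη : 0 < η) (hηr : η < r) (p : Euc d)
    {z : Euc d} (hzη : dist z p ≠ η) (hzr : dist z p ≠ r) (i : Fin d) :
    lineDeriv ℝ (fun z => ckTrunc d η r ‖z - p‖) z (EuclideanSpace.single i (1 : ℝ))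
      = (ball p r \ ball p η).indicator (fun z => ckGrad d (z - p) i) z := by
  have hcont : Continuous fun z : Euc d => ‖z - p‖ := by fun_prop
  rw [dist_eq_norm] at hzη hzr
  have hconst (c : ℝ) (h : (fun z => ckTrunc d η r ‖z - p‖) =ᶠ[𝓝 z] fun _ => c) :
      lineDeriv ℝ (fun z => ckTrunc d η r ‖z - p‖) z (EuclideanSpace.single i (1 : ℝ)) = 0 := by
    rw [h.lineDeriv_eq]
    simp [lineDeriv]
  rcases hzη.lt_or_gt with h1 | h1
  · rw [Set.indicator_of_notMem (by simp [dist_eq_norm, h1]), hconst (ckr d η - ckr d r)]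
    filter_upwards [hcont.continuousAt.eventually_lt_const h1] with y hy
    exact ckTrunc_of_le_left hηr.le hy.le
  rcases hzr.lt_or_gt with h2 | h2
  · rw [Set.indicator_of_mem (by simp [dist_eq_norm, h1.le, h2])]
    have hev : (fun z => ckTrunc d η r ‖z - p‖) =ᶠ[𝓝 z] fun z => ck d (z - p) - ckr d r := by
      filter_upwards [hcont.continuousAt.eventually_lt_const h2,
        hcont.continuousAt.eventually_const_lt h1] with y hy hy'
      exact ckTrunc_of_mem hy'.le hy.le
    have hz : z - p ≠ 0 := norm_pos_iff.1 (hη.trans h1)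
    have hd := (((hasGradientAt_ck d hz).hasFDerivAt.comp z
      ((hasFDerivAt_id z).sub_const p)).sub_const (ckr d r))
    rw [hev.lineDeriv_eq]
    refine (hd.hasLineDerivAt _).lineDeriv.trans ?_
    simp [EuclideanSpace.inner_single_right]
  · rw [Set.indicator_of_notMem (by simp [dist_eq_norm, h2.le]), hconst 0]
    filter_upwards [hcont.continuousAt.eventually_const_lt h2] with y hy
    exact ckTrunc_of_le hηr.le hy.le

lemma continuousOn_ckGrad_sub {d : ℕ} {p : Euc d} {s : Set (Euc d)} (hs : p ∉ s) :
    ContinuousOn (fun z => ckGrad d (z - p)) s := fun z hz => by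
  have hz' : z - p ≠ 0 := sub_ne_zero.2 fun h => hs (h ▸ hz)
  exact (ContinuousAt.comp (f := fun z => z - p) (contDiffAt_ckGrad d hz').continuousAt
    (by fun_prop)).continuousWithinAt

lemma isCompact_closedBall_sdiff_ball {d : ℕ} (p : Euc d) (r η : ℝ) :
    IsCompact (closedBall p r \ ball p η) :=
  (isCompact_closedBall p r).diff isOpen_ball

lemma neg_le_setIntegral_ckGrad_mul {d : ℕ} (hd : 2 ≤ d) {p : Euc d} {η r R M : ℝ} (hη : 0 < η)
    (hηr : η < r) (hrR : r < R) {v : Fin d → Euc d → ℝ}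
    (hv : ∀ i, ContDiffOn ℝ 1 (v i) (ball p R))
    (hM : ∀ x ∈ ball p R,
      ∑ i, fderiv ℝ (v i) x (EuclideanSpace.single i (1 : ℝ)) ≤ M) (hM0 : 0 ≤ M) :
    -(M * (cConst d * r ^ 2))
      ≤ ∫ z in ball p r \ ball p η, ∑ i, ckGrad d (z - p) i * v i z := by
  have : Nonempty (Fin d) := ⟨⟨0, by omega⟩⟩
  have hr : 0 < r := hη.trans hηr
  set φ : Euc d → ℝ := fun z => ckTrunc d η r ‖z - p‖ with hφ
  obtain ⟨C, hC⟩ := exists_lipschitzWith_ckTrunc (r := r) hd hη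
  have hφL : LipschitzWith (C * 1) φ :=
    hC.comp ((lipschitzWith_one_norm.comp
      (LipschitzWith.id.sub (LipschitzWith.const p))).weaken (by simp))
  have hφ0 : ∀ x ∉ closedBall p r, φ x = 0 := fun x hx => by
    rw [mem_closedBall, dist_eq_norm, not_le] at hx
    exact ckTrunc_of_le hηr.le hx.le
  have hcs : HasCompactSupport φ := HasCompactSupport.intro (isCompact_closedBall p r) hφ0
  have hφint : Integrable φ := hφL.continuous.integrable_of_hasCompactSupport hcs
  have hsub : closedBall p r ⊆ ball p R := closedBall_subset_ball hrR
  have hstep (i : Fin d) : ∫ z in ball p r \ ball p η, ckGrad d (z - p) i * v i z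
      = -∫ z in closedBall p r, φ z * fderiv ℝ (v i) z (EuclideanSpace.single i (1 : ℝ)) := by
    rw [setIntegral_eq_integral_of_forall_compl_eq_zero (s := closedBall p r)
      (fun z hz => by rw [hφ0 z hz, zero_mul]),
      ← integral_lineDeriv_mul_eq_neg hr hrR (hv i) hφL hφ0,
      ← integral_indicator (measurableSet_ball.diff measurableSet_ball)]
    refine integral_congr_ae ?_
    have h1 := measure_eq_zero_iff_ae_notMem.1 (Measure.addHaar_sphere volume p η)
    have h2 := measure_eq_zero_iff_ae_notMem.1 (Measure.addHaar_sphere volume p r)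
    filter_upwards [h1, h2] with z hz1 hz2
    rw [lineDeriv_ckTrunc hη hηr p hz1 hz2 i]
    by_cases hz : z ∈ ball p r \ ball p η <;> simp [hz]
  have hint1 (i : Fin d) :
      IntegrableOn (fun z => ckGrad d (z - p) i * v i z) (ball p r \ ball p η) := by
    refine IntegrableOn.mono_set (ContinuousOn.integrableOn_compact
      (isCompact_closedBall_sdiff_ball p r η) ?_) (Set.sdiff_subset_sdiff_left ball_subset_closedBall)
    refine ContinuousOn.mul ?_ ((hv i).continuousOn.mono (Set.sdiff_subset.trans hsub))
    exact (EuclideanSpace.proj i : Euc d →L[ℝ] ℝ).continuous.comp_continuousOn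
      (continuousOn_ckGrad_sub fun h => h.2 (mem_ball_self hη))
  have hint2 (i : Fin d) : IntegrableOn
      (fun z => φ z * fderiv ℝ (v i) z (EuclideanSpace.single i (1 : ℝ))) (closedBall p r) := by
    refine ContinuousOn.integrableOn_compact (isCompact_closedBall p r) ?_
    refine hφL.continuous.continuousOn.mul ?_
    exact (((hv i).continuousOn_fderiv_of_isOpen isOpen_ball le_rfl).clm_apply
      continuousOn_const).mono hsub
  rw [integral_finsetSum _ fun i _ => hint1 i, Finset.sum_congr rfl fun i _ => hstep i,
    Finset.sum_neg_distrib, ← integral_finsetSum _ fun i _ => hint2 i, neg_le_neg_iff]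
  calc ∫ z in closedBall p r, ∑ i, φ z * fderiv ℝ (v i) z (EuclideanSpace.single i (1 : ℝ))
      ≤ ∫ z in closedBall p r, M * φ z := by
        refine setIntegral_mono_on (integrable_finsetSum _ fun i _ => hint2 i)
          (hφint.const_mul M).integrableOn measurableSet_closedBall fun z hz => ?_
        rw [← Finset.mul_sum, mul_comm M]
        exact mul_le_mul_of_nonneg_left (hM z (hsub hz)) (ckTrunc_nonneg hd hη hηr.le)
    _ = M * ∫ z, φ z := by
        rw [integral_const_mul, setIntegral_eq_integral_of_forall_compl_eq_zero hφ0]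
    _ ≤ M * (cConst d * r ^ 2) := by
        gcongr
        exact integral_ckTrunc_le hd hη hηr.le p

lemma le_setIntegral_norm_ckGrad_add_sq {d : ℕ} (hd : 2 ≤ d) {p : Euc d} {η r R M : ℝ}
    (hη : 0 < η) (hηr : η < r) (hrR : r < R) {V : Euc d → Euc d}
    (hV : ContDiffOn ℝ 1 V (ball p R))
    (hM : ∀ x ∈ ball p R,
      ∑ i, fderiv ℝ (fun y => V y i) x (EuclideanSpace.single i (1 : ℝ)) ≤ M) (hM0 : 0 ≤ M) :
    cConst d * (ckr d η - ckr d r) - 2 * (M * (cConst d * r ^ 2))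
      ≤ ∫ z in ball p r \ ball p η, ‖ckGrad d (z - p) + V z‖ ^ 2 := by
  have hVi (i : Fin d) : ContDiffOn ℝ 1 (fun y => V y i) (ball p R) :=
    (EuclideanSpace.proj i : Euc d →L[ℝ] ℝ).contDiff.comp_contDiffOn hV
  have h1 := neg_le_setIntegral_ckGrad_mul hd hη hηr hrR hVi hM hM0
  have hsub : closedBall p r \ ball p η ⊆ ball p R :=
    Set.sdiff_subset.trans (closedBall_subset_ball hrR)
  have hW : ContinuousOn (fun z => ckGrad d (z - p)) (closedBall p r \ ball p η) :=
    continuousOn_ckGrad_sub fun h => h.2 (mem_ball_self hη)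
  have hVc : ContinuousOn V (closedBall p r \ ball p η) := hV.continuousOn.mono hsub
  have hint {f : Euc d → ℝ} (hf : ContinuousOn f (closedBall p r \ ball p η)) :
      IntegrableOn f (ball p r \ ball p η) :=
    (hf.integrableOn_compact (isCompact_closedBall_sdiff_ball p r η)).mono_set
      (Set.sdiff_subset_sdiff_left ball_subset_closedBall)
  have hin : (fun z => ∑ i, ckGrad d (z - p) i * V z i)
      = fun z => inner ℝ (ckGrad d (z - p)) (V z) := by
    ext z
    simp [PiLp.inner_apply, mul_comm]
  rw [hin] at h1
  have hint1 := hint (hW.norm.pow 2)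
  have hint2 := hint ((hW.inner hVc (𝕜 := ℝ)).const_smul (2 : ℝ))
  calc cConst d * (ckr d η - ckr d r) - 2 * (M * (cConst d * r ^ 2))
      ≤ (∫ z in ball p r \ ball p η, ‖ckGrad d (z - p)‖ ^ 2)
        + ∫ z in ball p r \ ball p η, (2 : ℝ) • inner ℝ (ckGrad d (z - p)) (V z) := by
        rw [setIntegral_norm_ckGrad_sq hd hη hηr.le, integral_smul, smul_eq_mul]
        linarith
    _ = ∫ z in ball p r \ ball p η,
          (‖ckGrad d (z - p)‖ ^ 2 + (2 : ℝ) • inner ℝ (ckGrad d (z - p)) (V z)) :=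
        (integral_add hint1 hint2).symm
    _ ≤ _ := by
        refine setIntegral_mono (hint1.add hint2) (hint ((hW.add hVc).norm.pow 2)) fun z => ?_
        simp only [norm_add_sq_real, smul_eq_mul]
        nlinarith [sq_nonneg ‖V z‖]

lemma gradient_apply {d : ℕ} (g : Euc d → ℝ) (x : Euc d) (i : Fin d) :
    gradient g x i = fderiv ℝ g x (EuclideanSpace.single i (1 : ℝ)) := by
  rw [← inner_gradient_left, EuclideanSpace.inner_single_right]
  simp

lemma ContDiffOn.gradient_of_isOpen {d : ℕ} {g : Euc d → ℝ} {Ω : Set (Euc d)}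
    (hg : ContDiffOn ℝ 2 g Ω) (hΩ : IsOpen Ω) : ContDiffOn ℝ 1 (gradient g) Ω :=
  (InnerProductSpace.toDual ℝ (Euc d)).symm.contDiff.comp_contDiffOn
    (hg.fderiv_of_isOpen hΩ (by norm_num))

lemma gradient_sum_ck_add {d : ℕ} {Λ : Finset (Euc d)} {g : Euc d → ℝ} {z : Euc d}
    (hg : DifferentiableAt ℝ g z) (hz : z ∉ Λ) :
    gradient (fun y => (∑ p ∈ Λ, ck d (y - p)) + g y) z
      = (∑ p ∈ Λ, ckGrad d (z - p)) + gradient g z := by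
  refine HasGradientAt.gradient ?_
  rw [hasGradientAt_iff_hasFDerivAt, map_add, map_sum]
  refine HasFDerivAt.add (HasFDerivAt.fun_sum fun p hp => ?_) hg.hasGradientAt.hasFDerivAt
  have hzp : z - p ≠ 0 := sub_ne_zero.2 fun h => hz (h ▸ hp)
  exact (hasGradientAt_ck d hzp).hasFDerivAt.comp z ((hasFDerivAt_id z).sub_const p)

lemma sum_fderiv_sum_ckGrad_add {d : ℕ} {Λ : Finset (Euc d)} {G : Euc d → Euc d} {x : Euc d}
    (hG : DifferentiableAt ℝ G x) (hx : x ∉ Λ) :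
    ∑ i, fderiv ℝ (fun y => ((∑ q ∈ Λ, ckGrad d (y - q)) + G y) i) x
        (EuclideanSpace.single i (1 : ℝ))
      = ∑ i, fderiv ℝ (fun y => G y i) x (EuclideanSpace.single i (1 : ℝ)) := by
  have hne (q) (hq : q ∈ Λ) : x - q ≠ 0 := sub_ne_zero.2 fun h => hx (h ▸ hq)
  have hproj (i : Fin d) {H : Euc d → Euc d} {y : Euc d} (hH : DifferentiableAt ℝ H y) :
      DifferentiableAt ℝ (fun y => H y i) y :=
    (EuclideanSpace.proj i : Euc d →L[ℝ] ℝ).differentiableAt.comp y hH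
  have hd (i : Fin d) (q) (hq : q ∈ Λ) :
      DifferentiableAt ℝ (fun y => ckGrad d (y - q) i) x :=
    hproj i (DifferentiableAt.comp x (g := ckGrad d) (f := fun y => y - q)
      ((contDiffAt_ckGrad d (hne q hq)).differentiableAt one_ne_zero) (by fun_prop))
  have key (i : Fin d) : fderiv ℝ (fun y => ((∑ q ∈ Λ, ckGrad d (y - q)) + G y) i) x
        (EuclideanSpace.single i (1 : ℝ))
      = (∑ q ∈ Λ, fderiv ℝ (fun y => ckGrad d y i) (x - q) (EuclideanSpace.single i (1 : ℝ)))
        + fderiv ℝ (fun y => G y i) x (EuclideanSpace.single i (1 : ℝ)) := by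
    have he : (fun y => ((∑ q ∈ Λ, ckGrad d (y - q)) + G y) i)
        = fun y => (∑ q ∈ Λ, ckGrad d (y - q) i) + G y i := by
      ext y
      simp
    rw [he, fderiv_fun_add (DifferentiableAt.fun_sum (hd i)) (hproj i hG),
      fderiv_fun_sum (hd i)]
    simp only [_root_.add_apply, _root_.sum_apply]
    congr 1
    refine Finset.sum_congr rfl fun q _ => ?_
    rw [fderiv_comp_sub (f := fun y => ckGrad d y i)]
  simp_rw [key, Finset.sum_add_distrib]
  rw [Finset.sum_comm, Finset.sum_eq_zero fun q hq => sum_fderiv_ckGrad d (hne q hq), zero_add]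

lemma ball_subset_of_le_infDist_frontier {d : ℕ} {U : Set (Euc d)} (hU : IsOpen U) {p : Euc d}
    (hp : p ∈ U) {r : ℝ} (hr : r ≤ infDist p (frontier U)) : ball p r ⊆ U := by
  rcases le_or_gt r 0 with h0 | h0
  · simp [ball_eq_empty.2 h0]
  have hdisj : Disjoint (ball p r) (frontier U) :=
    disjoint_ball_infDist.mono_left (ball_subset_ball hr)
  refine (convex_ball p r).isPreconnected.subset_left_of_subset_union hU
    (isClosed_closure (s := U)).isOpen_compl
    (disjoint_compl_right.mono_left subset_closure) (fun x hx => ?_) ⟨p, mem_ball_self h0, hp⟩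
  by_contra h
  rw [Set.mem_union, not_or, Set.mem_compl_iff, not_not] at h
  exact Set.disjoint_left.1 hdisj hx ⟨h.2, fun hi => h.1 (interior_subset hi)⟩

lemma le_liminf_real_of_nonpos {α : Type*} {l : Filter α} {f : α → ℝ} {c : ℝ} (hc : c ≤ 0)
    (h : ∀ᶠ x in l, c ≤ f x) : c ≤ liminf f l := by
  rw [liminf_eq]
  by_cases hb : BddAbove {a | ∀ᶠ x in l, a ≤ f x}
  · exact le_csSup hb h
  · rwa [Real.sSup_of_not_bddAbove hb]

/-- **Lower bound for the renormalized energy of well-separated configurations.**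
For `U` bounded open, `Λ ⊆ U` finite, `a` bounded continuous on `U` with `|a| ≤ A`, `g` a `C²`
function on a neighborhood of the closure of `U` with `Δg = c_d a` on `U`, and
`h = Σ_{p∈Λ} w(·−p) + g`, if the points of `Λ` are `η₀`-separated from each other and from
`∂U`, then `liminf_{η→0} (∫_{U∖⋃B(p,η)} |∇h|² − c_d w(η) #Λ) ≥ −C #Λ` with `C > 0` depending
only on `d`, `A` and `η₀`. -/
theorem renormalized_energy_lower_bound
    (d : ℕ) (hd : 2 ≤ d)
    (A η₀ : ℝ) (hA : 0 ≤ A) (hη₀ : 0 < η₀) :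
    ∃ C : ℝ, 0 < C ∧
      ∀ (U : Set (Euc d)), IsOpen U → Bornology.IsBounded U →
      ∀ (Λ : Finset (Euc d)), ↑Λ ⊆ U →
      ∀ (a : Euc d → ℝ), ContinuousOn a U → (∀ x ∈ U, |a x| ≤ A) →
      ∀ (g : Euc d → ℝ) (Ω : Set (Euc d)), IsOpen Ω → closure U ⊆ Ω → ContDiffOn ℝ 2 g Ω →
      (∀ x ∈ U, ∑ i : Fin d,
          fderiv ℝ (fun y => fderiv ℝ g y (EuclideanSpace.single i (1:ℝ))) x
            (EuclideanSpace.single i (1:ℝ)) = cConst d * a x) →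
      (∀ p ∈ Λ, ∀ q ∈ Λ, p ≠ q → η₀ ≤ dist p q) →
      (∀ p ∈ Λ, η₀ ≤ infDist p (frontier U)) →
      -C * Λ.card ≤
        Filter.liminf (fun η : ℝ =>
            (∫ z in U \ ⋃ p ∈ Λ, ball p η,
                ‖gradient (fun y => (∑ p ∈ Λ, ck d (y - p)) + g y) z‖ ^ 2)
              - cConst d * ckr d η * Λ.card)
          (𝓝[>] 0) := by
  have hc := cConst_nonneg hd
  set r : ℝ := η₀ / 2 with hr_def
  have hr : 0 < r := by positivity
  have hrη : r < η₀ := by linarith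
  set M : ℝ := cConst d * A with hM_def
  have hM0 : 0 ≤ M := by positivity
  refine ⟨cConst d * |ckr d r| + 2 * (M * (cConst d * r ^ 2)) + 1, by positivity, ?_⟩
  intro U hU hUb Λ hΛU a _ haA g Ω hΩ hUΩ hg hlap hsep hfr
  have hball (p) (hp : p ∈ Λ) : ball p η₀ ⊆ U :=
    ball_subset_of_le_infDist_frontier hU (hΛU hp) (hfr p hp)
  have hUΩ' : U ⊆ Ω := subset_closure.trans hUΩ
  have hgrad := hg.gradient_of_isOpen hΩ
  set F : Euc d → ℝ := fun z => ‖(∑ p ∈ Λ, ckGrad d (z - p)) + gradient g z‖ ^ 2 with hF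
  refine le_liminf_real_of_nonpos (mul_nonpos_of_nonpos_of_nonneg
    (neg_nonpos.2 (by positivity)) (Nat.cast_nonneg _)) ?_
  filter_upwards [Ioo_mem_nhdsGT hr] with η hη
  have hnot {z : Euc d} (hz : z ∉ ⋃ p ∈ Λ, ball p η) : z ∉ Λ := fun h =>
    hz (Set.mem_biUnion h (mem_ball_self hη.1))
  have hopen : IsOpen (⋃ p ∈ Λ, ball p η) := isOpen_biUnion fun p _ => isOpen_ball
  have hmeas : MeasurableSet (U \ ⋃ p ∈ Λ, ball p η) := hU.measurableSet.diff hopen.measurableSet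
  have hcongr : ∫ z in U \ ⋃ p ∈ Λ, ball p η,
      ‖gradient (fun y => (∑ p ∈ Λ, ck d (y - p)) + g y) z‖ ^ 2
        = ∫ z in U \ ⋃ p ∈ Λ, ball p η, F z := by
    refine setIntegral_congr_fun hmeas fun z hz => ?_
    have hgz : DifferentiableAt ℝ g z :=
      (hg.contDiffAt (hΩ.mem_nhds (hUΩ' hz.1))).differentiableAt two_ne_zero
    simp only [hF, gradient_sum_ck_add hgz (hnot hz.2)]
  have hFint : IntegrableOn F (U \ ⋃ p ∈ Λ, ball p η) := by
    have hK : IsCompact (closure U \ ⋃ p ∈ Λ, ball p η) := hUb.isCompact_closure.diff hopen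
    refine (ContinuousOn.integrableOn_compact hK ?_).mono_set
      (Set.sdiff_subset_sdiff_left subset_closure)
    refine (ContinuousOn.add (continuousOn_finsetSum _ fun p hp => ?_)
      (hgrad.continuousOn.mono (Set.sdiff_subset.trans hUΩ))).norm.pow 2
    exact continuousOn_ckGrad_sub fun h => hnot h.2 hp
  have hfar {p q z : Euc d} (hp : p ∈ Λ) (hq : q ∈ Λ) (hpq : p ≠ q) (hz : z ∈ ball p r) :
      z ∉ ball q r := fun hz' => by
    have h1 := hsep p hp q hq hpq
    have h2 := dist_triangle_left p q z
    rw [mem_ball] at hz hz'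
    linarith
  have hsub : ⋃ p ∈ Λ, (ball p r \ ball p η) ⊆ U \ ⋃ p ∈ Λ, ball p η := by
    refine Set.iUnion₂_subset fun p hp z hz => ⟨hball p hp (ball_subset_ball hrη.le hz.1), ?_⟩
    simp only [Set.mem_iUnion, not_exists]
    intro q hq hzq
    rcases eq_or_ne p q with rfl | hpq
    · exact hz.2 hzq
    · exact hfar hp hq hpq hz.1 (ball_subset_ball hη.2.le hzq)
  have hmono : ∑ p ∈ Λ, ∫ z in ball p r \ ball p η, F z ≤ ∫ z in U \ ⋃ p ∈ Λ, ball p η, F z := by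
    rw [← integral_biUnion_finset Λ (fun p _ => measurableSet_ball.diff measurableSet_ball)
      (fun p hp q hq hpq => Set.disjoint_left.2 fun z hz hz' => hfar hp hq hpq hz.1 hz'.1)
      (fun p hp => hFint.mono_set ((Set.subset_biUnion_of_mem (u := fun p => ball p r \ ball p η)
        hp).trans hsub))]
    exact setIntegral_mono_set hFint (Eventually.of_forall fun z => by positivity)
      hsub.eventuallyLE
  have hlocal (p) (hp : p ∈ Λ) : cConst d * (ckr d η - ckr d r) - 2 * (M * (cConst d * r ^ 2))
      ≤ ∫ z in ball p r \ ball p η, F z := by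
    have hne {x : Euc d} (hx : x ∈ ball p η₀) : x ∉ Λ.erase p := fun h => by
      have h1 := hsep x (Finset.mem_of_mem_erase h) p hp (Finset.ne_of_mem_erase h)
      rw [mem_ball] at hx
      linarith
    have h := le_setIntegral_norm_ckGrad_add_sq hd (p := p) hη.1 hη.2 hrη (M := M)
      (V := fun z => (∑ q ∈ Λ.erase p, ckGrad d (z - q)) + gradient g z) ?_ ?_ hM0
    · refine h.trans_eq (congrArg _ (funext fun z => ?_))
      rw [hF, ← add_assoc, Finset.add_sum_erase Λ (fun q => ckGrad d (z - q)) hp]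
    · refine ContDiffOn.add (ContDiffOn.sum fun q hq x hx => ?_)
        (hgrad.mono ((hball p hp).trans hUΩ'))
      have hxq : x - q ≠ 0 := sub_ne_zero.2 fun h => hne hx (h ▸ hq)
      exact (ContDiffAt.comp (g := ckGrad d) (f := fun y => y - q) x (contDiffAt_ckGrad d hxq)
        (by fun_prop)).contDiffWithinAt
    · intro x hx
      have hxU := hball p hp hx
      rw [sum_fderiv_sum_ckGrad_add ((hgrad.contDiffAt
        (hΩ.mem_nhds (hUΩ' hxU))).differentiableAt one_ne_zero) (hne hx)]
      simp_rw [gradient_apply]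
      rw [hlap x hxU]
      exact mul_le_mul_of_nonneg_left ((le_abs_self _).trans (haA x hxU)) hc
  have hsum := (Finset.card_nsmul_le_sum Λ _ _ hlocal).trans hmono
  rw [nsmul_eq_mul] at hsum
  rw [hcongr]
  have h1 : 0 ≤ (Λ.card : ℝ) * (cConst d * |ckr d r| - cConst d * ckr d r) :=
    mul_nonneg (Nat.cast_nonneg _) (sub_nonneg.2 (mul_le_mul_of_nonneg_left (le_abs_self _) hc))
  have h2 : (0 : ℝ) ≤ Λ.card := Nat.cast_nonneg _
  linarith
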